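/- Let K be a separable metric space such that the j-th derived set K^(j) is non-empty for every j = 1, 2, 3, .... Then there exists a bounded function f : K → ℝ which belongs to DBSC(K) but not to SD(K). -/

import Mathlib

open Filter Topology Set

noncomputable section

/-- A real-valued function is bounded. -/
def BddFun {X : Type*} (f : X → ℝ) : Prop := ∃ C, ∀ x, |f x| ≤ C

/-- `f ∈ DBSC(X)`: `f` is a difference of bounded lower semicontinuous functions. -/
def MemDBSC {X : Type*} [TopologicalSpace X] (f : X → ℝ) : Prop :=
  ∃ u v : X → ℝ, BddFun u ∧ BddFun v ∧ LowerSemicontinuous u ∧ LowerSemicontinuous v ∧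
    f = u - v

/-- The D-norm of `f`. -/
def DNorm {X : Type*} [TopologicalSpace X] (f : X → ℝ) : ℝ :=
  sInf {c | ∃ φ : ℕ → X → ℝ, (∀ j, Continuous (φ j)) ∧ (∀ x, Summable fun j => |φ j x|) ∧
    (∀ x, ∑' j, φ j x = f x) ∧ (∀ x, ∑' j, |φ j x| ≤ c)}

/-- The sup-norm of `f`. -/
def supNorm {X : Type*} (f : X → ℝ) : ℝ := ⨆ x, |f x|

/-- A simple D-function: a D-function taking finitely many values. -/
def SimpleD {X : Type*} [TopologicalSpace X] (f : X → ℝ) : Prop :=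
  MemDBSC f ∧ (Set.range f).Finite

/-- `f ∈ SD(X)`: `f` is a strong D-function. -/
def MemSD {X : Type*} [TopologicalSpace X] (f : X → ℝ) : Prop :=
  ∃ φ : ℕ → X → ℝ, (∀ n, SimpleD (φ n)) ∧
    Tendsto (fun n => DNorm (f - φ n)) atTop (𝓝 0)

/-- `f ∈ B_{1/2}(X)`: `f` is a uniform limit of D-functions. -/
def MemBHalf {X : Type*} [TopologicalSpace X] (f : X → ℝ) : Prop :=
  ∃ g : ℕ → X → ℝ, (∀ n, MemDBSC (g n)) ∧ TendstoUniformly g f atTop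

/-- The upper semicontinuous envelope `Uf`. -/
def uEnv {X : Type*} [TopologicalSpace X] (f : X → ℝ) (x : X) : ℝ :=
  sInf {c | ∃ V : Set X, IsOpen V ∧ x ∈ V ∧ sSup (f '' V) = c}

/-- The lower oscillation of `f` at `x`. -/
def losc {X : Type*} [TopologicalSpace X] (f : X → ℝ) (x : X) : ℝ :=
  sInf {c | ∃ V : Set X, IsOpen V ∧ x ∈ V ∧ sSup ((fun y => |f y - f x|) '' V) = c}

/-- The oscillation of `f`: `osc f = U (losc f)`. -/
def osc {X : Type*} [TopologicalSpace X] (f : X → ℝ) : X → ℝ := uEnv (losc f)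

/-- The oscillation sets `os_n(f, ε)`. -/
def osSet {X : Type*} [TopologicalSpace X] (f : X → ℝ) (ε : ℝ) : ℕ → Set X
  | 0 => Set.univ
  | n + 1 => {x | ∃ h : x ∈ osSet f ε n, ε ≤ osc ((osSet f ε n).restrict f) ⟨x, h⟩}

/-- The `ε`-oscillation index `i(f, ε) = sup {n : os_n(f,ε) ≠ ∅}`. -/
def oscIndex {X : Type*} [TopologicalSpace X] (f : X → ℝ) (ε : ℝ) : ℕ∞ :=
  ⨆ (m : ℕ) (_ : (osSet f ε m).Nonempty), (m : ℕ∞)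

/-- `f` has finite Baire index. -/
def FiniteBaireIndex {X : Type*} [TopologicalSpace X] (f : X → ℝ) : Prop :=
  ∃ n : ℕ, ∀ ε > 0, osSet f ε n = ∅

/-- The Baire index `i(f) = sup_{ε > 0} i(f, ε)`. -/
def baireIndex {X : Type*} [TopologicalSpace X] (f : X → ℝ) : ℕ∞ :=
  ⨆ (ε : ℝ) (_ : 0 < ε), oscIndex f ε

open scoped ENNReal

/-- The derived set of `s`: the set of cluster (accumulation) points of `s`. -/
def derivSet {X : Type*} [TopologicalSpace X] (s : Set X) : Set X :=
  {x | x ∈ closure (s \ {x})}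

/-- The iterated derived sets `K^(j)` of the whole space. -/
def iterDeriv (X : Type*) [TopologicalSpace X] : ℕ → Set X
  | 0 => Set.univ
  | n + 1 => derivSet (iterDeriv X n)

/-- A nonnegative lower semicontinuous function on a metric space is the pointwise sum of a series
of nonnegative continuous functions. -/
lemma LowerSemicontinuous.exists_hasSum_continuous {X : Type*} [PseudoMetricSpace X] {u : X → ℝ}
    (hu : LowerSemicontinuous u) (h0 : ∀ x, 0 ≤ u x) :
    ∃ ψ : ℕ → X → ℝ, (∀ k, Continuous (ψ k)) ∧ (∀ k x, 0 ≤ ψ k x) ∧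
      ∀ x, HasSum (fun k => ψ k x) (u x) := by
  rcases isEmpty_or_nonempty X with hX | hX
  · exact ⟨fun _ _ => 0, fun _ => continuous_const, fun _ _ => le_rfl, fun x => isEmptyElim x⟩
  let U : ℕ → X → ℝ := fun n x => ⨅ y, (u y + n * dist x y)
  have hpos : ∀ (n : ℕ) (x y : X), 0 ≤ u y + n * dist x y := fun n x y => by
    have := h0 y; positivity
  have hbdd : ∀ (n : ℕ) (x : X), BddBelow (range fun y => u y + n * dist x y) := fun n x =>
    ⟨0, by rintro _ ⟨y, rfl⟩; exact hpos n x y⟩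
  have hU0 : ∀ n x, 0 ≤ U n x := fun n x => le_ciInf (hpos n x)
  have hUle : ∀ n x, U n x ≤ u x := fun n x => by
    simpa using ciInf_le (hbdd n x) x
  have hUmono : ∀ n x, U n x ≤ U (n + 1) x := fun n x =>
    ciInf_mono (hbdd n x) fun y => by
      have := dist_nonneg (x := x) (y := y)
      push_cast
      nlinarith
  have hUc : ∀ n, Continuous (U n) := fun n => by
    refine (LipschitzWith.of_le_add_mul (n : NNReal) fun x y => ?_).continuous
    rw [← sub_le_iff_le_add]
    refine le_ciInf fun z => ?_
    have h1 : U n x ≤ u z + n * dist x z := ciInf_le (hbdd n x) z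
    have h2 : (n : ℝ) * dist x z ≤ n * (dist x y + dist y z) := by
      gcongr; exact dist_triangle x y z
    simp only [NNReal.coe_natCast]
    linarith
  have hUt : ∀ x, Tendsto (fun n => U n x) atTop (𝓝 (u x)) := fun x => by
    rw [tendsto_order]
    refine ⟨fun a ha => ?_, fun a ha => Eventually.of_forall fun n => (hUle n x).trans_lt ha⟩
    obtain ⟨b, hab, hb⟩ := exists_between ha
    obtain ⟨r, hr, hball⟩ := Metric.eventually_nhds_iff.1 (hu x b hb)
    obtain ⟨N, hN⟩ := exists_nat_gt (u x / r)
    filter_upwards [eventually_ge_atTop N] with n hn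
    refine hab.trans_le (le_ciInf fun y => ?_)
    by_cases hy : dist y x < r
    · have := hball hy
      have : 0 ≤ (n : ℝ) * dist x y := by positivity
      linarith
    · have h1 : u x < N * r := (div_lt_iff₀ hr).1 hN
      have h2 : (N : ℝ) * r ≤ n * dist x y := by
        rw [dist_comm x y]
        gcongr
        exact not_lt.1 hy
      have := h0 y
      linarith
  let W : ℕ → X → ℝ := fun n => Nat.casesOn n (fun _ => 0) U
  have hWc : ∀ n, Continuous (W n) := fun n => by
    cases n with
    | zero => exact continuous_const
    | succ n => exact hUc n
  have hWmono : ∀ n x, 0 ≤ W (n + 1) x - W n x := fun n x => by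
    cases n with
    | zero => simpa [W] using hU0 0 x
    | succ n => exact sub_nonneg.2 (hUmono n x)
  refine ⟨fun k x => W (k + 1) x - W k x, fun k => (hWc (k + 1)).sub (hWc k), hWmono, fun x => ?_⟩
  rw [hasSum_iff_tendsto_nat_of_nonneg fun k => hWmono k x]
  simp only [Finset.sum_range_sub (fun k => W k x)]
  rw [← tendsto_add_atTop_iff_nat 1]
  simpa [W] using hUt x

/-- The pointwise sum of a series of nonnegative continuous functions is lower semicontinuous. -/
lemma lowerSemicontinuous_of_hasSum {X : Type*} [TopologicalSpace X] {w : X → ℝ}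
    {ψ : ℕ → X → ℝ} (hc : ∀ k, Continuous (ψ k)) (h0 : ∀ k x, 0 ≤ ψ k x)
    (hs : ∀ x, HasSum (fun k => ψ k x) (w x)) : LowerSemicontinuous w := by
  intro x a ha
  obtain ⟨N, hN⟩ := ((hs x).tendsto_sum_nat.eventually (lt_mem_nhds ha)).exists
  have hcont : Continuous fun y => ∑ k ∈ Finset.range N, ψ k y :=
    continuous_finsetSum _ fun k _ => hc k
  filter_upwards [hcont.continuousAt.eventually (lt_mem_nhds hN)] with y hy
  exact hy.trans_le (sum_le_hasSum _ (fun k _ => h0 k y) (hs y))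

/-- On a metric space, the set of admissible bounds defining the D-norm of a function in `DBSC`
is nonempty. -/
lemma MemDBSC.exists_series {X : Type*} [PseudoMetricSpace X] {f : X → ℝ} (hf : MemDBSC f) :
    ∃ c, ∃ φ : ℕ → X → ℝ, (∀ j, Continuous (φ j)) ∧ (∀ x, Summable fun j => |φ j x|) ∧
      (∀ x, ∑' j, φ j x = f x) ∧ (∀ x, ∑' j, |φ j x| ≤ c) := by
  obtain ⟨u, v, ⟨C, hC⟩, ⟨D, hD⟩, hu, hv, rfl⟩ := hf
  have hCl : ∀ x, 0 ≤ u x + (|C| + |D|) := fun x => by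
    have := neg_le_of_abs_le (hC x); have := le_abs_self C; have := abs_nonneg D; linarith
  have hDl : ∀ x, 0 ≤ v x + (|C| + |D|) := fun x => by
    have := neg_le_of_abs_le (hD x); have := le_abs_self D; have := abs_nonneg C; linarith
  obtain ⟨α, hαc, hα0, hαs⟩ := LowerSemicontinuous.exists_hasSum_continuous
    (hu.add (lowerSemicontinuous_const (z := |C| + |D|))) hCl
  obtain ⟨β, hβc, hβ0, hβs⟩ := LowerSemicontinuous.exists_hasSum_continuous
    (hv.add (lowerSemicontinuous_const (z := |C| + |D|))) hDl
  have hle : ∀ x j, |α j x - β j x| ≤ α j x + β j x := fun x j => by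
    rw [abs_le]; constructor <;> linarith [hα0 j x, hβ0 j x]
  have hsum : ∀ x, Summable fun j => |α j x - β j x| := fun x =>
    Summable.of_nonneg_of_le (fun _ => abs_nonneg _) (hle x)
      ((hαs x).summable.add (hβs x).summable)
  refine ⟨(C + (|C| + |D|)) + (D + (|C| + |D|)), fun j x => α j x - β j x,
    fun j => (hαc j).sub (hβc j), hsum, fun x => ?_, fun x => ?_⟩
  · rw [((hαs x).sub (hβs x)).tsum_eq, Pi.sub_apply]
    ring
  · refine ((hsum x).tsum_le_tsum (hle x) ((hαs x).add (hβs x)).summable).trans ?_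
    rw [((hαs x).add (hβs x)).tsum_eq]
    have := le_of_abs_le (hC x)
    have := le_of_abs_le (hD x)
    linarith

/-- If `t` has a chain of length `n` at `x`, then for every assignment of neighbourhoods there are
points starting at `x`, each in the neighbourhood assigned to its predecessor, along which `t`
takes the values `0, 1, …, n`. -/
def HasChain {X : Type*} [TopologicalSpace X] (t : X → ℕ) (n : ℕ) (x : X) : Prop :=
  ∀ U : X → Set X, (∀ p, U p ∈ 𝓝 p) → ∃ p : ℕ → X, p 0 = x ∧ (∀ j ≤ n, t (p j) = j) ∧
    ∀ j < n, p (j + 1) ∈ U (p j)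

/-- An accumulation point of `A` is approached by points of `A` having pairwise disjoint open
neighbourhoods, none of which contains the accumulation point. -/
lemma exists_disjoint_nhds_of_mem_derivSet {X : Type*} [MetricSpace X] {A V : Set X} {x : X}
    (hx : x ∈ derivSet A) (hV : V ∈ 𝓝 x) :
    ∃ (s : ℕ → X) (B : ℕ → Set X), (∀ i, s i ∈ A) ∧ (∀ i, s i ∈ B i) ∧ (∀ i, IsOpen (B i)) ∧
      (∀ i, B i ⊆ V) ∧ (∀ i, x ∉ B i) ∧ Pairwise (Function.onFun Disjoint B) ∧
      ∀ U ∈ 𝓝 x, ∃ i, s i ∈ U := by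
  obtain ⟨r, hr, hrV⟩ := Metric.mem_nhds_iff.1 hV
  have hex : ∀ ε > 0, ∃ y ∈ A, 0 < dist y x ∧ dist y x < ε := fun ε hε => by
    obtain ⟨y, hy, hd⟩ := Metric.mem_closure_iff.1 hx ε hε
    exact ⟨y, hy.1, dist_pos.2 hy.2, by rwa [dist_comm]⟩
  let S := {y : X // y ∈ A ∧ 0 < dist y x}
  have hnext : ∀ y : S, ∃ z : S, dist z.1 x < dist y.1 x / 4 := fun y => by
    obtain ⟨z, hz, hz0, hzl⟩ := hex (dist y.1 x / 4) (by linarith [y.2.2])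
    exact ⟨⟨z, hz, hz0⟩, hzl⟩
  choose next hnext using hnext
  obtain ⟨y₀, hy₀, hy₀0, hy₀r⟩ := hex (r / 4) (by linarith)
  let s : ℕ → S := fun n => Nat.rec ⟨y₀, hy₀, hy₀0⟩ (fun _ y => next y) n
  have hstep : ∀ n, dist (s (n + 1)).1 x < dist (s n).1 x / 4 := fun n => hnext (s n)
  have hanti : ∀ i j, i < j → dist (s j).1 x ≤ dist (s i).1 x / 4 := fun i j hij => by
    induction j, hij using Nat.le_induction with
    | base => exact (hstep i).le
    | succ j _ ih => linarith [hstep j, (s j).2.2]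
  have hgeom : ∀ n, dist (s n).1 x ≤ r / 4 * (1 / 4) ^ n := fun n => by
    induction n with
    | zero => simpa [s] using hy₀r.le
    | succ n ih => rw [pow_succ]; linarith [hstep n]
  have hle : ∀ n, dist (s n).1 x ≤ r / 4 := fun n =>
    (hgeom n).trans (mul_le_of_le_one_right (by linarith) (pow_le_one₀ (by norm_num) (by norm_num)))
  refine ⟨fun n => (s n).1, fun n => Metric.ball (s n).1 (dist (s n).1 x / 2), fun n => (s n).2.1,
    fun n => Metric.mem_ball_self (by linarith [(s n).2.2]), fun n => Metric.isOpen_ball,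
    fun n y hy => hrV ?_, fun n hn => ?_, ?_, fun U hU => ?_⟩
  · rw [Metric.mem_ball] at hy ⊢
    linarith [dist_triangle y (s n).1 x, hle n]
  · rw [Metric.mem_ball, dist_comm] at hn
    linarith [(s n).2.2]
  · refine (pairwise_disjoint_on _).2 fun i j hij => Set.disjoint_left.2 fun y hyi hyj => ?_
    rw [Metric.mem_ball] at hyi hyj
    have h1 := dist_triangle y (s j).1 x
    have h2 := dist_triangle_left (s i).1 x y
    linarith [hanti i j hij, (s i).2.2]
  · obtain ⟨ε, hε, hεU⟩ := Metric.mem_nhds_iff.1 hU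
    have hlim : Tendsto (fun n : ℕ => r / 4 * (1 / 4 : ℝ) ^ n) atTop (𝓝 0) := by
      simpa using (tendsto_pow_atTop_nhds_zero_of_lt_one (by norm_num : (0 : ℝ) ≤ 1 / 4)
        (by norm_num)).const_mul (r / 4)
    obtain ⟨n, hn⟩ := (hlim.eventually (gt_mem_nhds hε)).exists
    exact ⟨n, hεU (Metric.mem_ball.2 ((hgeom n).trans_lt hn))⟩

/-- A supremum of nonnegative terms, at most one of which is nonzero. -/
lemma ciSup_eq_of_forall_ne_eq_zero {ι α : Type*} [ConditionallyCompleteLattice α] [Zero α]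
    {g : ι → α} (i : ι) (hi : 0 ≤ g i) (h : ∀ j, j ≠ i → g j = 0) : ⨆ j, g j = g i := by
  have hle : ∀ j, g j ≤ g i := fun j => by
    by_cases hj : j = i
    · rw [hj]
    · rw [h j hj]; exact hi
  have : Nonempty ι := ⟨i⟩
  exact le_antisymm (ciSup_le hle) (le_ciSup ⟨g i, by rintro _ ⟨j, rfl⟩; exact hle j⟩ i)

/-- Around each point of the `n`-th derived set there is a lower semicontinuous function with
values in `{0, …, n}` having a chain of length `n`. -/
lemma exists_hasChain {X : Type*} [MetricSpace X] (n : ℕ) {x : X} (hx : x ∈ iterDeriv X n)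
    {V : Set X} (hV : IsOpen V) (hxV : x ∈ V) :
    ∃ t : X → ℕ, LowerSemicontinuous t ∧ (∀ y ∉ V, t y = 0) ∧ (∀ y, t y ≤ n) ∧
      HasChain t n x := by
  induction n generalizing x V with
  | zero =>
    exact ⟨fun _ => 0, lowerSemicontinuous_const, fun _ _ => rfl, fun _ => le_rfl,
      fun U _ => ⟨fun _ => x, rfl, fun j hj => (Nat.le_zero.1 hj).symm, fun j hj => by omega⟩⟩
  | succ n ih =>
    obtain ⟨s, B, hsA, hsB, hBo, hBV, hxB, hdisj, hlim⟩ :=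
      exists_disjoint_nhds_of_mem_derivSet hx (hV.mem_nhds hxV)
    choose t htl ht0 htn htc using fun i => ih (hsA i) (hBo i) (hsB i)
    have hbdd : ∀ y, BddAbove (range fun i => t i y) := fun y =>
      ⟨n, by rintro _ ⟨i, rfl⟩; exact htn i y⟩
    have hsup : ∀ i, ∀ y ∈ B i, ⨆ j, t j y = t i y := fun i y hy =>
      ciSup_eq_of_forall_ne_eq_zero i (Nat.zero_le _) fun j hj =>
        ht0 j y (Set.disjoint_right.1 (hdisj hj) hy)
    have hsup0 : ∀ y, (∀ i, y ∉ B i) → ⨆ j, t j y = 0 := fun y hy => by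
      simp [fun j => ht0 j y (hy j)]
    let W : Set X := V \ {x}
    have hW : IsOpen W := hV.sdiff isClosed_singleton
    refine ⟨fun y => W.indicator (fun _ => 1) y + ⨆ i, t i y,
      (hW.lowerSemicontinuous_indicator zero_le_one).add (lowerSemicontinuous_ciSup hbdd htl),
      fun y hy => ?_, fun y => ?_, fun U hU => ?_⟩
    · have hyW : y ∉ W := fun h => hy h.1
      dsimp only
      rw [indicator_of_notMem hyW, hsup0 y fun i hi => hy (hBV i hi)]
    · have h1 : ⨆ i, t i y ≤ n := ciSup_le fun i => htn i y
      have h2 : W.indicator (fun _ => 1) y ≤ 1 :=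
        indicator_apply_le' (fun _ => le_rfl) (fun _ => Nat.zero_le _)
      dsimp only
      omega
    · obtain ⟨i, hi⟩ := hlim (U x) (hU x)
      obtain ⟨p, hp0, hpt, hpU⟩ := htc i U hU
      have hpB : ∀ j ≤ n, p j ∈ B i := fun j hj => by
        cases j with
        | zero => rw [hp0]; exact hsB i
        | succ j =>
          by_contra h
          have h1 := ht0 i _ h
          rw [hpt _ hj] at h1
          omega
      refine ⟨fun j => Nat.casesOn j x p, rfl, fun j hj => ?_, fun j hj => ?_⟩
      · cases j with
        | zero => simp [W, hsup0 x hxB]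
        | succ j =>
          have hj' : j ≤ n := by omega
          have hmem : p j ∈ W :=
            ⟨hBV i (hpB j hj'), fun h => hxB i (mem_singleton_iff.1 h ▸ hpB j hj')⟩
          change W.indicator (fun _ => 1) (p j) + ⨆ i, t i (p j) = j + 1
          rw [indicator_of_mem hmem, hsup i _ (hpB j hj'), hpt j hj', add_comm]
      · cases j with
        | zero => simpa [hp0] using hi
        | succ j => exact hpU j (by omega)

lemma derivSet_mono {X : Type*} [TopologicalSpace X] {s t : Set X} (h : s ⊆ t) :
    derivSet s ⊆ derivSet t :=
  fun _ hx => closure_mono (sdiff_subset_sdiff_left h) hx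

lemma iterDeriv_antitone (X : Type*) [TopologicalSpace X] : Antitone (iterDeriv X) := by
  refine antitone_nat_of_succ_le fun n => ?_
  induction n with
  | zero => exact subset_univ _
  | succ n ih => exact derivSet_mono ih

/-- An open set meeting all derived sets contains two disjoint open sets, one meeting the `n`-th
derived set and the other one meeting all derived sets. -/
lemma exists_disjoint_split {X : Type*} [MetricSpace X] {A : Set X} (hA : IsOpen A)
    (h : ∀ n, (A ∩ iterDeriv X n).Nonempty) (n : ℕ) :
    ∃ V A' : Set X, IsOpen V ∧ (V ∩ iterDeriv X n).Nonempty ∧ V ⊆ A ∧ A' ⊆ A ∧ Disjoint V A' ∧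
      IsOpen A' ∧ ∀ m, (A' ∩ iterDeriv X m).Nonempty := by
  obtain ⟨x, hxA, hx⟩ := h (n + 1)
  obtain ⟨y, hyA, hy, hyx⟩ := mem_closure_iff.1 hx A hA hxA
  have hd : 0 < dist x y := dist_pos.2 fun h => hyx h.symm
  have key : ∀ z ∈ A, z ∈ iterDeriv X n →
      (∀ m, (A \ Metric.closedBall z (dist x y / 3) ∩ iterDeriv X m).Nonempty) →
      ∃ V A' : Set X, IsOpen V ∧ (V ∩ iterDeriv X n).Nonempty ∧ V ⊆ A ∧ A' ⊆ A ∧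
        Disjoint V A' ∧ IsOpen A' ∧ ∀ m, (A' ∩ iterDeriv X m).Nonempty := fun z hzA hz hm =>
    ⟨A ∩ Metric.ball z (dist x y / 3), A \ Metric.closedBall z (dist x y / 3),
      hA.inter Metric.isOpen_ball, ⟨z, ⟨hzA, Metric.mem_ball_self (by positivity)⟩, hz⟩,
      inter_subset_left, sdiff_subset,
      Set.disjoint_left.2 fun w hw hw' => hw'.2 (Metric.ball_subset_closedBall hw.2),
      hA.sdiff Metric.isClosed_closedBall, hm⟩
  by_cases hm : ∀ m, (A \ Metric.closedBall x (dist x y / 3) ∩ iterDeriv X m).Nonempty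
  · exact key x hxA (iterDeriv_antitone X n.le_succ hx) hm
  · push Not at hm
    obtain ⟨m, hm⟩ := hm
    refine key y hyA hy fun k => ?_
    obtain ⟨z, hzA, hz⟩ := h (max m k)
    refine ⟨z, ⟨hzA, fun hzy => ?_⟩, iterDeriv_antitone X (le_max_right m k) hz⟩
    have hzx : z ∈ Metric.closedBall x (dist x y / 3) := by
      by_contra hzx
      have : z ∈ A \ Metric.closedBall x (dist x y / 3) ∩ iterDeriv X m :=
        ⟨⟨hzA, hzx⟩, iterDeriv_antitone X (le_max_left m k) hz⟩
      rw [hm] at this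
      exact this
    rw [Metric.mem_closedBall] at hzx hzy
    linarith [dist_triangle_left x y z]

/-- If all derived sets are nonempty, there are pairwise disjoint open sets, the `n`-th of which
meets the `n`-th derived set. -/
lemma exists_disjoint_isOpen_inter_iterDeriv {X : Type*} [MetricSpace X]
    (h : ∀ n, (iterDeriv X n).Nonempty) :
    ∃ V : ℕ → Set X, (∀ n, IsOpen (V n)) ∧ (∀ n, (V n ∩ iterDeriv X n).Nonempty) ∧
      Pairwise (Function.onFun Disjoint V) := by
  let Q := {A : Set X // IsOpen A ∧ ∀ n, (A ∩ iterDeriv X n).Nonempty}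
  choose V A' hVo hVn hVA hA'A hdisj hA' using fun A : Q => exists_disjoint_split A.2.1 A.2.2
  let A : ℕ → Q := fun n => Nat.rec ⟨univ, isOpen_univ, fun n => by simpa using h n⟩
    (fun n B => ⟨A' B n, hA' B n⟩) n
  have hanti : Antitone fun n => (A n).1 := antitone_nat_of_succ_le fun n => hA'A (A n) n
  refine ⟨fun n => V (A n) n, fun n => hVo _ _, fun n => hVn _ _,
    (pairwise_disjoint_on _).2 fun i j hij => ?_⟩
  exact (hdisj (A i) i).mono_right ((hVA (A j) j).trans (hanti (Nat.succ_le_of_lt hij)))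

/-- Along points at which the bounded function `a` drops by at most `ε` in each of `n` steps, the
variation of `a` is controlled. -/
lemma sum_abs_sub_le_of_drop_le {a : ℕ → ℝ} {ε M : ℝ} {n : ℕ}
    (hstep : ∀ j < n, a j - ε < a (j + 1)) (hM : a n - a 0 ≤ M) (hε : 0 ≤ ε) :
    ∑ j ∈ Finset.range n, |a (j + 1) - a j| ≤ M + 2 * ε * n := by
  calc ∑ j ∈ Finset.range n, |a (j + 1) - a j|
      ≤ ∑ j ∈ Finset.range n, (a (j + 1) - a j + 2 * ε) :=
        Finset.sum_le_sum fun j hj => by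
          have := hstep j (Finset.mem_range.1 hj)
          rw [abs_le]; constructor <;> linarith
    _ ≤ M + 2 * ε * n := by
        rw [Finset.sum_add_distrib, Finset.sum_range_sub]
        simp only [Finset.sum_const, Finset.card_range, nsmul_eq_mul]
        linarith

lemma Set.Finite.exists_pos_le_abs_sub {s : Set ℝ} (hs : s.Finite) :
    ∃ η > 0, ∀ a ∈ s, ∀ b ∈ s, a ≠ b → η ≤ |a - b| := by
  have hF : ((fun p : ℝ × ℝ => |p.1 - p.2|) '' s.offDiag).Finite := hs.offDiag.image _
  have h0 : (0 : ℝ) ∉ (fun p : ℝ × ℝ => |p.1 - p.2|) '' s.offDiag := by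
    rintro ⟨p, hp, h⟩
    exact hp.2.2 (sub_eq_zero.1 (abs_eq_zero.1 h))
  obtain ⟨η, hη, hball⟩ := Metric.isOpen_iff.1 hF.isClosed.isOpen_compl 0 h0
  refine ⟨η, hη, fun a ha b hb hab => not_lt.1 fun hlt => ?_⟩
  exact hball (show |a - b| ∈ Metric.ball 0 η by simpa using hlt) ⟨(a, b), ⟨ha, hb, hab⟩, rfl⟩

/-- A function which, for every `n` and every assignment of neighbourhoods, jumps by
`1 / (n + 1)` in each of `n` steps along a chain of points respecting the assignment, is not a
strong D-function. -/
lemma not_memSD_of_chains {X : Type*} [PseudoMetricSpace X] {f : X → ℝ} (hf : MemDBSC f)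
    (hchain : ∀ (n : ℕ) (U : X → Set X), (∀ p, U p ∈ 𝓝 p) → ∃ p : ℕ → X,
      ∀ j < n, p (j + 1) ∈ U (p j) ∧ |f (p (j + 1)) - f (p j)| = 1 / ((n : ℝ) + 1)) :
    ¬ MemSD f := by
  rintro ⟨φ, hφ, hlim⟩
  obtain ⟨k, hk⟩ := (hlim.eventually (gt_mem_nhds (show (0 : ℝ) < 1 / 8 by norm_num))).exists
  obtain ⟨⟨a, b, ⟨C, hC⟩, ⟨D, hD⟩, ha, hb, hab⟩, hfin⟩ := hφ k
  have hg : MemDBSC (f - φ k) := by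
    obtain ⟨u, v, ⟨C', hC'⟩, ⟨D', hD'⟩, hu, hv, rfl⟩ := hf
    refine ⟨u + b, v + a, ⟨C' + D, fun x => (abs_add_le _ _).trans (add_le_add (hC' x) (hD x))⟩,
      ⟨D' + C, fun x => (abs_add_le _ _).trans (add_le_add (hD' x) (hC x))⟩, hu.add hb,
      hv.add ha, ?_⟩
    rw [hab]; abel
  obtain ⟨δ, ⟨ψ, hψc, hψs, hψf, hψb⟩, hδ⟩ := exists_lt_of_csInf_lt hg.exists_series hk
  have hpos_le : ∀ x j, max (ψ j x) 0 ≤ |ψ j x| := fun x j => max_le (le_abs_self _) (abs_nonneg _)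
  have hneg_le : ∀ x j, max (-ψ j x) 0 ≤ |ψ j x| :=
    fun x j => max_le (neg_le_abs _) (abs_nonneg _)
  have hcs : ∀ x, Summable fun j => max (ψ j x) 0 := fun x =>
    Summable.of_nonneg_of_le (fun _ => le_max_right _ _) (hpos_le x) (hψs x)
  have hds : ∀ x, Summable fun j => max (-ψ j x) 0 := fun x =>
    Summable.of_nonneg_of_le (fun _ => le_max_right _ _) (hneg_le x) (hψs x)
  let c : X → ℝ := fun x => ∑' j, max (ψ j x) 0
  let d : X → ℝ := fun x => ∑' j, max (-ψ j x) 0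
  have hc : LowerSemicontinuous c := lowerSemicontinuous_of_hasSum
    (fun j => (hψc j).max continuous_const) (fun _ _ => le_max_right _ _) fun x => (hcs x).hasSum
  have hd : LowerSemicontinuous d := lowerSemicontinuous_of_hasSum
    (fun j => (hψc j).neg.max continuous_const) (fun _ _ => le_max_right _ _)
    fun x => (hds x).hasSum
  have hc0 : ∀ x, 0 ≤ c x := fun x => tsum_nonneg fun _ => le_max_right _ _
  have hd0 : ∀ x, 0 ≤ d x := fun x => tsum_nonneg fun _ => le_max_right _ _
  have hcδ : ∀ x, c x ≤ δ := fun x => ((hcs x).tsum_le_tsum (hpos_le x) (hψs x)).trans (hψb x)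
  have hdδ : ∀ x, d x ≤ δ := fun x => ((hds x).tsum_le_tsum (hneg_le x) (hψs x)).trans (hψb x)
  have hcd : ∀ x, f x = c x - d x + φ k x := fun x => by
    have h1 : c x - d x = f x - φ k x := by
      rw [← Pi.sub_apply f, ← hψf x, ← (hcs x).tsum_sub (hds x)]
      refine tsum_congr fun j => ?_
      rcases le_total 0 (ψ j x) with h | h
      · rw [max_eq_left h, max_eq_right (neg_nonpos.2 h), sub_zero]
      · rw [max_eq_right h, max_eq_left (neg_nonneg.2 h)]; ring
    linarith
  obtain ⟨η, hη, hgap⟩ := hfin.exists_pos_le_abs_sub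
  obtain ⟨n, hn⟩ := exists_nat_gt (1 + 2 * ((2 * C + 2 * D + 1) / η))
  have hn1 : (0 : ℝ) < n + 1 := by positivity
  set ε : ℝ := 1 / (16 * (n + 1)) with hεdef
  have hε : 0 < ε := by positivity
  have hεn : ε * n ≤ 1 / 16 := by
    rw [hεdef, div_mul_eq_mul_div, div_le_div_iff₀ (by positivity) (by norm_num)]
    linarith
  obtain ⟨p, hp⟩ := hchain n
    (fun x => {y | a x - ε < a y ∧ b x - ε < b y ∧ c x - ε < c y ∧ d x - ε < d y}) fun x =>
      (ha x _ (sub_lt_self _ hε)).and ((hb x _ (sub_lt_self _ hε)).and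
        ((hc x _ (sub_lt_self _ hε)).and (hd x _ (sub_lt_self _ hε))))
  have hva := sum_abs_sub_le_of_drop_le (a := fun j => a (p j)) (M := 2 * C)
    (fun j hj => (hp j hj).1.1)
    (by linarith [le_of_abs_le (hC (p n)), neg_le_of_abs_le (hC (p 0))]) hε.le
  have hvb := sum_abs_sub_le_of_drop_le (a := fun j => b (p j)) (M := 2 * D)
    (fun j hj => (hp j hj).1.2.1)
    (by linarith [le_of_abs_le (hD (p n)), neg_le_of_abs_le (hD (p 0))]) hε.le
  have hvc := sum_abs_sub_le_of_drop_le (a := fun j => c (p j)) (M := δ)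
    (fun j hj => (hp j hj).1.2.2.1) (by linarith [hcδ (p n), hc0 (p 0)]) hε.le
  have hvd := sum_abs_sub_le_of_drop_le (a := fun j => d (p j)) (M := δ)
    (fun j hj => (hp j hj).1.2.2.2) (by linarith [hdδ (p n), hd0 (p 0)]) hε.le
  have hstep : ∀ j ∈ Finset.range n, 1 / ((n : ℝ) + 1) ≤
      |c (p (j + 1)) - c (p j)| + |d (p (j + 1)) - d (p j)| +
        (|a (p (j + 1)) - a (p j)| + |b (p (j + 1)) - b (p j)|) * (1 / (η * (n + 1))) := by
    intro j hj
    have hjump := (hp j (Finset.mem_range.1 hj)).2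
    by_cases heq : φ k (p (j + 1)) = φ k (p j)
    · have h1 : f (p (j + 1)) - f (p j) =
          (c (p (j + 1)) - c (p j)) - (d (p (j + 1)) - d (p j)) := by
        rw [hcd, hcd (p j), heq]; ring
      rw [h1] at hjump
      have h2 := abs_sub (c (p (j + 1)) - c (p j)) (d (p (j + 1)) - d (p j))
      have h3 : 0 ≤ (|a (p (j + 1)) - a (p j)| + |b (p (j + 1)) - b (p j)|) *
        (1 / (η * (n + 1))) := by positivity
      linarith
    · have h1 := hgap _ (mem_range_self (p (j + 1))) _ (mem_range_self (p j)) heq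
      have h2 : φ k (p (j + 1)) - φ k (p j) =
          (a (p (j + 1)) - a (p j)) - (b (p (j + 1)) - b (p j)) := by
        rw [hab]; simp only [Pi.sub_apply]; ring
      rw [h2] at h1
      have h3 := h1.trans (abs_sub (a (p (j + 1)) - a (p j)) (b (p (j + 1)) - b (p j)))
      have h4 : η * (1 / (η * (n + 1))) ≤
          (|a (p (j + 1)) - a (p j)| + |b (p (j + 1)) - b (p j)|) * (1 / (η * (n + 1))) := by
        gcongr
      have h5 : η * (1 / (η * ((n : ℝ) + 1))) = 1 / (n + 1) := by field_simp
      linarith [abs_nonneg (c (p (j + 1)) - c (p j)), abs_nonneg (d (p (j + 1)) - d (p j))]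
  have hsum := Finset.sum_le_sum hstep
  rw [Finset.sum_add_distrib, Finset.sum_add_distrib, ← Finset.sum_mul, Finset.sum_add_distrib,
    Finset.sum_const, Finset.card_range, nsmul_eq_mul] at hsum
  have hvab : (∑ j ∈ Finset.range n, |a (p (j + 1)) - a (p j)| +
      ∑ j ∈ Finset.range n, |b (p (j + 1)) - b (p j)|) * (1 / (η * (n + 1))) ≤
      (2 * C + 2 * D + 1) * (1 / (η * (n + 1))) :=
    mul_le_mul_of_nonneg_right (by linarith) (by positivity)
  have hfinal : (n : ℝ) * (1 / (n + 1)) ≤ 1 / 2 + (2 * C + 2 * D + 1) * (1 / (η * (n + 1))) := by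
    linarith
  have hmul := mul_le_mul_of_nonneg_right hfinal hn1.le
  have e1 : (n : ℝ) * (1 / (n + 1)) * (n + 1) = n := by field_simp
  have e2 : (1 / 2 + (2 * C + 2 * D + 1) * (1 / (η * (n + 1)))) * ((n : ℝ) + 1) =
      (n + 1) / 2 + (2 * C + 2 * D + 1) / η := by field_simp
  rw [e1, e2] at hmul
  linarith

/-- Suprema of scaled monotone functions of the terms of a sequence of lower semicontinuous
functions with disjoint supports. -/
lemma exists_lowerSemicontinuous_glue {X : Type*} [TopologicalSpace X] {V : ℕ → Set X}
    (hV : Pairwise (Function.onFun Disjoint V)) {t : ℕ → X → ℕ}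
    (htl : ∀ n, LowerSemicontinuous (t n)) (ht0 : ∀ n, ∀ y ∉ V n, t n y = 0)
    (htn : ∀ n y, t n y ≤ n) {g : ℕ → ℕ} (hg : Monotone g) (hg0 : g 0 = 0)
    (hgle : ∀ m, g m ≤ m) :
    ∃ w : X → ℝ, LowerSemicontinuous w ∧ (∀ y, |w y| ≤ 1) ∧
      ∀ n, ∀ y ∈ V n, w y = g (t n y) / ((n : ℝ) + 1) := by
  have h0 : ∀ n y, 0 ≤ (g (t n y) : ℝ) / ((n : ℝ) + 1) := fun n y => by positivity
  have h1 : ∀ n y, (g (t n y) : ℝ) / ((n : ℝ) + 1) ≤ 1 := fun n y => by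
    rw [div_le_one (by positivity)]
    exact_mod_cast ((hgle _).trans (htn n y)).trans n.le_succ
  have hbdd : ∀ y, BddAbove (range fun n : ℕ => (g (t n y) : ℝ) / ((n : ℝ) + 1)) := fun y =>
    ⟨1, by rintro _ ⟨n, rfl⟩; exact h1 n y⟩
  refine ⟨fun y => ⨆ n : ℕ, (g (t n y) : ℝ) / ((n : ℝ) + 1),
    lowerSemicontinuous_ciSup hbdd fun n => ?_, fun y => ?_, fun n y hy => ?_⟩
  · refine Continuous.comp_lowerSemicontinuous
      (g := fun m : ℕ => (g m : ℝ) / ((n : ℝ) + 1)) continuous_of_discreteTopology (htl n)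
      fun m m' hm => ?_
    have := hg hm
    dsimp only
    gcongr
  · rw [abs_of_nonneg (Real.iSup_nonneg fun n => h0 n y)]
    exact ciSup_le fun n => h1 n y
  · refine ciSup_eq_of_forall_ne_eq_zero n (h0 n y) fun m hm => ?_
    rw [ht0 m y (Set.disjoint_right.1 (hV hm) hy), hg0]
    simp

/-- **Proposition 1.5.** If `K^(j) ≠ ∅` for all `j ≥ 1`, then there is a bounded
function in `DBSC(K)` which is not in `SD(K)`. -/
theorem exists_DBSC_not_SD {K : Type*} [MetricSpace K]
    [TopologicalSpace.SeparableSpace K]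
    (hder : ∀ j : ℕ, 1 ≤ j → (iterDeriv K j).Nonempty) :
    ∃ f : K → ℝ, BddFun f ∧ MemDBSC f ∧ ¬ MemSD f := by
  obtain ⟨V, hVo, hVn, hV⟩ := exists_disjoint_isOpen_inter_iterDeriv fun n =>
    (hder (n + 1) n.succ_pos).mono (iterDeriv_antitone K n.le_succ)
  choose x hxV hx using hVn
  choose t htl ht0 htn htc using fun n => exists_hasChain n (hx n) (hVo n) (hxV n)
  obtain ⟨u, hul, hub, hu⟩ := exists_lowerSemicontinuous_glue hV htl ht0 htn
    (g := fun m => (m + 1) / 2) (fun _ _ h => Nat.div_le_div_right (Nat.add_le_add_right h 1)) rfl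
    (fun m => by omega)
  obtain ⟨v, hvl, hvb, hv⟩ := exists_lowerSemicontinuous_glue hV htl ht0 htn
    (g := fun m => m / 2) (fun _ _ h => Nat.div_le_div_right h) rfl (fun m => by omega)
  have hf : MemDBSC (u - v) := ⟨u, v, ⟨1, hub⟩, ⟨1, hvb⟩, hul, hvl, rfl⟩
  refine ⟨u - v, ⟨1 + 1, fun y => (abs_sub _ _).trans (add_le_add (hub y) (hvb y))⟩, hf,
    not_memSD_of_chains hf fun n U hU => ?_⟩
  obtain ⟨p, hp0, hpt, hpU⟩ := htc n U hU
  have hpV : ∀ j ≤ n, p j ∈ V n := fun j hj => by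
    cases j with
    | zero => rw [hp0]; exact hxV n
    | succ j =>
      by_contra h
      have h1 := ht0 n _ h
      rw [hpt _ hj] at h1
      omega
  have hval : ∀ j ≤ n, (u - v) (p j) = ((j % 2 : ℕ) : ℝ) / ((n : ℝ) + 1) := fun j hj => by
    rw [Pi.sub_apply, hu n _ (hpV j hj), hv n _ (hpV j hj), hpt j hj, ← sub_div]
    congr 1
    rw [sub_eq_iff_eq_add]
    norm_cast
    omega
  refine ⟨p, fun j hj => ⟨hpU j hj, ?_⟩⟩
  rw [hval j hj.le, hval (j + 1) hj, ← sub_div, abs_div, abs_of_pos (by positivity : (0 : ℝ) < n + 1)]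
  congr 1
  rcases Nat.mod_two_eq_zero_or_one j with h | h
  · rw [h, show (j + 1) % 2 = 1 by omega]; norm_num
  · rw [h, show (j + 1) % 2 = 0 by omega]; norm_num
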